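/- arXiv:2601.10262 — 2 statements merged into one kernel-verified Lean document; each statement's English description precedes it below -/
import Mathlib

section
/- Q_π satisfies Q_π = Q_π^t and Q_π² = I_N, and for every subset A ⊆ {0,…,N−1}, the dual of the monomial code C_{G_N}(A) is C_{G_N}(A)^⊥ = C_{G_N·Q_π}(Ǎᶜ), where Ǎᶜ = {N−1−i : i ∈ {0,…,N−1} ∖ A}. -/
open Matrix

/-- The set of positions of nonzero bits (within `{0,…,m−1}`) of the binary expansion of `i`. -/
def bsupp (m i : ℕ) : Finset ℕ := (Finset.range m).filter fun k => i.testBit k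

/-- The polar transform matrix `G_N`, `N = 2^m`: entry `(i,j)` is `1` iff `supp j ⊆ supp i`. -/
def GN (m : ℕ) : Matrix (Fin (2^m)) (Fin (2^m)) (ZMod 2) :=
  fun i j => if bsupp m (j : ℕ) ⊆ bsupp m (i : ℕ) then 1 else 0

/-- The permutation matrix swapping `i` and `N−1−i`. -/
def Qpi (m : ℕ) : Matrix (Fin (2^m)) (Fin (2^m)) (ZMod 2) :=
  fun i j => if (j : ℕ) = 2^m - 1 - (i : ℕ) then 1 else 0

/-- The linear code spanned by the rows of `B` with index in `A`. -/
def code {N : ℕ} (B : Matrix (Fin N) (Fin N) (ZMod 2)) (A : Set (Fin N)) :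
    Submodule (ZMod 2) (Fin N → ZMod 2) :=
  Submodule.span (ZMod 2) ((fun i => B i) '' A)

/-- The dual code of a linear code `C ⊆ 𝔽₂^N`. -/
def dualCode {N : ℕ} (C : Submodule (ZMod 2) (Fin N → ZMod 2)) :
    Submodule (ZMod 2) (Fin N → ZMod 2) where
  carrier := {v | ∀ c ∈ C, ∑ k, v k * c k = 0}
  zero_mem' := by intro c hc; simp
  add_mem' := by
    intro a b ha hb c hc
    have h1 := ha c hc
    have h2 := hb c hc
    simp only [Pi.add_apply, add_mul, Finset.sum_add_distrib, h1, h2, add_zero]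
  smul_mem' := by
    intro r v hv c hc
    have h := hv c hc
    simp only [Pi.smul_apply, smul_eq_mul, mul_assoc, ← Finset.mul_sum, h, mul_zero]

/-- The index reversal `i ↦ N − 1 − i` on `Fin (2^m)`. -/
def rev (m : ℕ) (i : Fin (2^m)) : Fin (2^m) :=
  ⟨2^m - 1 - (i : ℕ), by have := i.isLt; omega⟩

theorem bsupp_subset_bsupp_iff (m i j : ℕ) :
    bsupp m j ⊆ bsupp m i ↔ ∀ k < m, j.testBit k = true → i.testBit k = true := by
  simp only [bsupp, Finset.subset_iff, Finset.mem_filter, Finset.mem_range]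
  exact ⟨fun h k hk hj => (h ⟨hk, hj⟩).2, fun h k hk => ⟨hk.1, h k hk.1 hk.2⟩⟩

theorem testBit_rev (m : ℕ) (i : Fin (2 ^ m)) {k : ℕ} (hk : k < m) :
    (rev m i : ℕ).testBit k = !(i : ℕ).testBit k := by
  have h := Nat.testBit_two_pow_sub_succ i.isLt k
  simpa [rev, Nat.sub_sub, Nat.add_comm, hk] using h

theorem rev_rev (m : ℕ) (i : Fin (2 ^ m)) : rev m (rev m i) = i := by
  have := i.isLt
  ext
  simp only [rev]
  omega

theorem Qpi_apply (m : ℕ) (i j : Fin (2 ^ m)) : Qpi m i j = if i = rev m j then 1 else 0 := by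
  have := i.isLt
  have := j.isLt
  have h : (j : ℕ) = 2 ^ m - 1 - i ↔ i = rev m j := by
    simp only [Fin.ext_iff, rev]
    omega
  simp only [Qpi, h]

theorem mul_Qpi_apply (m : ℕ) (B : Matrix (Fin (2 ^ m)) (Fin (2 ^ m)) (ZMod 2))
    (i j : Fin (2 ^ m)) : (B * Qpi m) i j = B i (rev m j) := by
  simp [Matrix.mul_apply, Qpi_apply]

theorem Qpi_mul_Qpi (m : ℕ) : Qpi m * Qpi m = 1 := by
  ext i j
  rw [mul_Qpi_apply, Qpi_apply, rev_rev, Matrix.one_apply]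

/-- The rows of `G_N Q_π`, in reverse order, are the columns of `G_N`. -/
theorem GN_mul_Qpi_rev_apply (m : ℕ) (b j : Fin (2 ^ m)) :
    (GN m * Qpi m) (rev m b) j = GN m j b := by
  have h : bsupp m (rev m j) ⊆ bsupp m (rev m b) ↔ bsupp m b ⊆ bsupp m j := by
    simp only [bsupp_subset_bsupp_iff]
    refine forall₂_congr fun k hk => ?_
    rw [testBit_rev m j hk, testBit_rev m b hk]
    cases (j : ℕ).testBit k <;> cases (b : ℕ).testBit k <;> simp
  rw [mul_Qpi_apply]
  simp only [GN, h]

theorem bsupp_injective (m : ℕ) : Function.Injective fun i : Fin (2 ^ m) => bsupp m i := by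
  intro i j h
  refine Fin.ext (Nat.eq_of_testBit_eq fun k => ?_)
  by_cases hk : k < m
  · have hij := (bsupp_subset_bsupp_iff m j i).1 h.subset k hk
    have hji := (bsupp_subset_bsupp_iff m i j).1 h.superset k hk
    exact Bool.eq_iff_iff.2 ⟨hij, hji⟩
  · have hle : 2 ^ m ≤ 2 ^ k := Nat.pow_le_pow_right two_pos (not_lt.1 hk)
    rw [Nat.testBit_lt_two_pow (i.isLt.trans_le hle), Nat.testBit_lt_two_pow (j.isLt.trans_le hle)]

/-- Flipping the bit `k` of an index, for `k < m`. -/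
def flipBit (m k : ℕ) (hk : k < m) (j : Fin (2 ^ m)) : Fin (2 ^ m) :=
  ⟨(j : ℕ) ^^^ 2 ^ k, Nat.xor_lt_two_pow j.isLt (Nat.pow_lt_pow_right one_lt_two hk)⟩

theorem flipBit_flipBit (m k : ℕ) (hk : k < m) (j : Fin (2 ^ m)) :
    flipBit m k hk (flipBit m k hk j) = j := by
  ext
  simp [flipBit]

theorem flipBit_ne (m k : ℕ) (hk : k < m) (j : Fin (2 ^ m)) : flipBit m k hk j ≠ j := by
  intro h
  have h' := congrArg (fun i : Fin (2 ^ m) => (i : ℕ).testBit k) h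
  simp [flipBit, Nat.testBit_xor, Nat.testBit_two_pow_self] at h'

theorem testBit_flipBit_of_ne (m k : ℕ) (hk : k < m) (j : Fin (2 ^ m)) {l : ℕ} (hl : l ≠ k) :
    (flipBit m k hk j : ℕ).testBit l = (j : ℕ).testBit l := by
  simp [flipBit, Nat.testBit_xor, Nat.testBit_two_pow_of_ne hl.symm]

/-- A row of `G_N` is invariant under flipping a bit in the support of its index. -/
theorem GN_apply_flipBit_right (m k : ℕ) (hk : k < m) (a j : Fin (2 ^ m))
    (ha : (a : ℕ).testBit k = true) : GN m a (flipBit m k hk j) = GN m a j := by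
  have h : bsupp m (flipBit m k hk j) ⊆ bsupp m a ↔ bsupp m j ⊆ bsupp m a := by
    simp only [bsupp_subset_bsupp_iff]
    refine forall₂_congr fun l _ => ?_
    by_cases hl : l = k
    · simp [hl, ha]
    · rw [testBit_flipBit_of_ne m k hk j hl]
  simp only [GN, h]

/-- A column of `G_N` is invariant under flipping a bit outside the support of its index. -/
theorem GN_apply_flipBit_left (m k : ℕ) (hk : k < m) (b j : Fin (2 ^ m))
    (hb : ¬ (b : ℕ).testBit k = true) : GN m (flipBit m k hk j) b = GN m j b := by
  have h : bsupp m b ⊆ bsupp m (flipBit m k hk j) ↔ bsupp m b ⊆ bsupp m j := by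
    simp only [bsupp_subset_bsupp_iff]
    refine forall₂_congr fun l _ => ?_
    by_cases hl : l = k
    · simp [hl, hb]
    · rw [testBit_flipBit_of_ne m k hk j hl]
  simp only [GN, h]

theorem GN_mul_GN (m : ℕ) : GN m * GN m = 1 := by
  ext a b
  rw [Matrix.mul_apply]
  by_cases hba : bsupp m b ⊆ bsupp m a
  · by_cases hab : bsupp m a ⊆ bsupp m b
    · obtain rfl : a = b := bsupp_injective m (hab.antisymm hba)
      rw [Matrix.one_apply_eq, Finset.sum_eq_single a]
      · simp [GN]
      · intro j _ hj
        by_contra hne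
        have h : bsupp m a ⊆ bsupp m j ∧ bsupp m j ⊆ bsupp m a := by
          simpa [GN] using hne
        exact hj (bsupp_injective m (h.2.antisymm h.1))
      · simp
    · have hne : a ≠ b := fun h => hab (h ▸ subset_rfl)
      rw [Matrix.one_apply_ne hne]
      obtain ⟨k, hk, ha, hb⟩ : ∃ k < m, (a : ℕ).testBit k = true ∧ ¬ (b : ℕ).testBit k = true := by
        simpa [bsupp_subset_bsupp_iff] using hab
      refine Finset.sum_involution (fun j _ => flipBit m k hk j) (fun j _ => ?_)
        (fun j _ _ => flipBit_ne m k hk j) (fun _ _ => Finset.mem_univ _)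
        (fun j _ => flipBit_flipBit m k hk j)
      rw [GN_apply_flipBit_right m k hk a j ha, GN_apply_flipBit_left m k hk b j hb]
      exact CharTwo.add_self_eq_zero _
  · have hne : a ≠ b := fun h => hba (h ▸ subset_rfl)
    rw [Matrix.one_apply_ne hne]
    refine Finset.sum_eq_zero fun j _ => ?_
    by_contra h
    have h' : bsupp m b ⊆ bsupp m j ∧ bsupp m j ⊆ bsupp m a := by
      simpa [GN] using h
    exact hba (h'.1.trans h'.2)

theorem mem_dualCode_code_iff {N : ℕ} (B : Matrix (Fin N) (Fin N) (ZMod 2)) (A : Set (Fin N))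
    (v : Fin N → ZMod 2) : v ∈ dualCode (code B A) ↔ ∀ a ∈ A, (B *ᵥ v) a = 0 := by
  have hB (a : Fin N) : (B *ᵥ v) a = ∑ k, v k * B a k := by
    simp only [Matrix.mulVec, dotProduct, mul_comm]
  simp only [hB]
  refine ⟨fun h a ha => h _ (Submodule.subset_span ⟨a, ha, rfl⟩), fun h c hc => ?_⟩
  induction hc using Submodule.span_induction with
  | mem x hx =>
    obtain ⟨a, ha, rfl⟩ := hx
    exact h a ha
  | zero => simp
  | add x y _ _ hx hy => simp [mul_add, Finset.sum_add_distrib, hx, hy]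
  | smul r x _ hx => simp [mul_left_comm _ r, ← Finset.mul_sum, hx]

/-- If `B * C = 1`, the code dual to the rows of `B` in `A` is spanned by the columns of `C`
outside `A`. -/
theorem dualCode_code_eq_of_mul_eq_one {N : ℕ} {B C : Matrix (Fin N) (Fin N) (ZMod 2)}
    (h : B * C = 1) (A : Set (Fin N)) : dualCode (code B A) = code Cᵀ Aᶜ := by
  apply le_antisymm
  · intro v hv
    rw [mem_dualCode_code_iff] at hv
    have hsum : v = ∑ b, (B *ᵥ v) b • Cᵀ b := by
      have hCB : C *ᵥ (B *ᵥ v) = v := by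
        rw [Matrix.mulVec_mulVec, mul_eq_one_comm.1 h, Matrix.one_mulVec]
      refine hCB.symm.trans ((Matrix.mulVec_eq_sum _ _).trans ?_)
      simp only [op_smul_eq_smul]
    rw [hsum]
    refine Submodule.sum_mem _ fun b _ => ?_
    by_cases hb : b ∈ A
    · simp [hv b hb]
    · exact Submodule.smul_mem _ _ (Submodule.subset_span ⟨b, hb, rfl⟩)
  · refine Submodule.span_le.2 ?_
    rintro _ ⟨b, hb, rfl⟩
    refine (mem_dualCode_code_iff B A _).2 fun a ha => ?_
    have hab : a ≠ b := fun hab => hb (hab ▸ ha)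
    calc (B *ᵥ Cᵀ b) a = (B * C) a b := rfl
      _ = 0 := by rw [h, Matrix.one_apply_ne hab]

/-- `Q_π = Q_πᵗ`, `Q_π² = I_N`, and for every `A ⊆ {0,…,N−1}`,
`C_{G_N}(A)^⊥ = C_{G_N·Q_π}(Ǎᶜ)` where `Ǎᶜ = {N−1−i : i ∉ A}`. -/
theorem stmt2 (m : ℕ) (hm : 0 < m) :
    Qpi m = (Qpi m)ᵀ
    ∧ Qpi m * Qpi m = 1
    ∧ ∀ A : Set (Fin (2^m)),
        dualCode (code (GN m) A) = code (GN m * Qpi m) (rev m '' Aᶜ) := by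
  refine ⟨?_, Qpi_mul_Qpi m, fun A => ?_⟩
  · ext i j
    have h : i = rev m j ↔ j = rev m i :=
      ⟨fun h => by rw [h, rev_rev], fun h => by rw [h, rev_rev]⟩
    simp only [Matrix.transpose_apply, Qpi_apply, h]
  · rw [dualCode_code_eq_of_mul_eq_one (GN_mul_GN m)]
    simp only [code, Set.image_image]
    congr 2
    ext b j
    exact (GN_mul_Qpi_rev_apply m b j).symm
end

section
/- Let P be an N×N upper triangular matrix over 𝔽₂ with all diagonal entries equal to 1, let A ⊆ {0,…,N−1} have nonempty complement, and let t = max(Aᶜ). Then C_{G_N}({t+1,…,N−1}) ⊆ C_{P·G_N}(A), and the 𝔽₂-dimension of C_{G_N}({t+1,…,N−1}) equals N−1−t. -/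
theorem le_of_bsupp_subset {m i j : ℕ} (hj : j < 2 ^ m) (h : bsupp m j ⊆ bsupp m i) : j ≤ i := by
  have hand : j &&& i = j := by
    refine Nat.eq_of_testBit_eq fun k => ?_
    rw [Nat.testBit_and]
    cases hk : j.testBit k with
    | false => rfl
    | true =>
      have hkm : k < m := by
        by_contra! hmk
        simp [Nat.testBit_lt_two_pow (hj.trans_le (Nat.pow_le_pow_right two_pos hmk))] at hk
      have hmem : k ∈ bsupp m i := h (by simp [bsupp, hk, hkm])
      simpa [bsupp, hkm] using hmem
  exact hand ▸ Nat.and_le_right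

theorem det_GN (m : ℕ) : (GN m).det = 1 := by
  have htri : (GN m).BlockTriangular OrderDual.toDual := fun i j hij =>
    if_neg fun h => (not_lt_of_ge (le_of_bsupp_subset j.isLt h)) hij
  rw [Matrix.det_of_isLowerTriangular _ htri]
  simp [GN]

theorem linearIndependent_GN (m : ℕ) : LinearIndependent (ZMod 2) (GN m).row :=
  Matrix.linearIndependent_rows_of_det_ne_zero (A := GN m) (by simp [det_GN])

/-- If `A` contains every index above `t`, the code of an upper unipotent transform `P * B`
contains every row of `B` above `t`. -/
theorem row_mem_code_mul {N : ℕ} {P : Matrix (Fin N) (Fin N) (ZMod 2)}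
    (B : Matrix (Fin N) (Fin N) (ZMod 2)) (hupper : ∀ i j, j < i → P i j = 0)
    (hdiag : ∀ i, P i i = 1) {A : Set (Fin N)} {t : Fin N} (hA : ∀ i, t < i → i ∈ A)
    (i : Fin N) (hi : t < i) : B i ∈ code (P * B) A := by
  induction i using WellFoundedGT.induction with
  | ind i ih =>
    have hrow : (P * B) i = B i + ∑ j ∈ Finset.univ.erase i, P i j • B j := by
      have hsum : (P * B) i = ∑ j, P i j • B j := by
        ext k
        simp [Matrix.mul_apply]
      rw [hsum, ← Finset.add_sum_erase _ _ (Finset.mem_univ i), hdiag, one_smul]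
    rw [eq_sub_of_add_eq hrow.symm]
    refine sub_mem (Submodule.subset_span ⟨i, hA i hi, rfl⟩) (sum_mem fun j hj => ?_)
    rcases lt_or_gt_of_ne (Finset.ne_of_mem_erase hj) with hji | hij
    · simp [hupper i j hji]
    · exact Submodule.smul_mem _ _ (ih j hij (hi.trans hij))

/-- let `P` be upper triangular with unit diagonal over `𝔽₂`, let
`A ⊆ {0,…,N−1}` have nonempty complement, and `t = max(Aᶜ)`.  Then
`C_{G_N}({t+1,…,N−1}) ⊆ C_{P·G_N}(A)`, and `dim C_{G_N}({t+1,…,N−1}) = N−1−t`. -/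
theorem stmt11 (m : ℕ) (hm : 0 < m)
    (P : Matrix (Fin (2^m)) (Fin (2^m)) (ZMod 2))
    (hupper : ∀ i j : Fin (2^m), j < i → P i j = 0)
    (hdiag : ∀ i : Fin (2^m), P i i = 1)
    (A : Finset (Fin (2^m))) (hc : Aᶜ.Nonempty) :
    code (GN m) {i : Fin (2^m) | Aᶜ.max' hc < i} ≤ code (P * GN m) ↑A
    ∧ Module.finrank (ZMod 2) (code (GN m) {i : Fin (2^m) | Aᶜ.max' hc < i})
        = 2^m - 1 - (Aᶜ.max' hc : ℕ) := by
  constructor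
  · refine Submodule.span_le.2 ?_
    rintro _ ⟨i, hi, rfl⟩
    refine row_mem_code_mul _ hupper hdiag (fun j hj => ?_) i hi
    by_contra hjA
    exact not_lt_of_ge (Aᶜ.le_max' j (Finset.mem_compl.2 hjA)) hj
  · rw [code, ← Set.range_domRestrict]
    refine (finrank_span_eq_card
      ((linearIndependent_GN m).comp _ Subtype.val_injective)).trans ?_
    rw [← Fin.card_Ioi, ← Fintype.card_coe]
    exact Fintype.card_congr (Equiv.subtypeEquivRight fun i => by simp)
end
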